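/- arXiv:2208.10073 — 2 statements merged into one kernel-verified Lean document; each statement's English description precedes it below -/
import Mathlib

section
/- Let ℓ ∈ {0,1,2}, h_ℓ(t) = cot^ℓ(πt) csc²(πt), and let τ_1,…,τ_r be points on the torus 𝕋 = ℝ/ℤ with minimal wrap-around distance Δ(τ) satisfying (n+1)Δ(τ) ≥ α for some α > 0. Let u_{i,j} be reals with (n+1)|u_{i,j}| ≤ β < α/2 and u_{i,i} = 0. Then for every index i, the sum S_ℓ = ∑_{j≠i} h_ℓ(τ_j − τ_i + u_{i,j}) satisfies S_ℓ ≤ (2/(πΔ(τ)))^{ℓ+2} · 1/((ℓ+1)(1 − 2β/α)^{ℓ+1}). -/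
open Real

/-- The minimal wrap-around distance `Δ(τ) = min_{ℓ≠ℓ'} inf_{p∈ℤ} |τ_ℓ − τ_{ℓ'} + p|`. -/
noncomputable def sep {r : ℕ} (τ : Fin r → ℝ) : ℝ :=
  sInf {d : ℝ | ∃ (i j : Fin r) (p : ℤ), i ≠ j ∧ d = |τ i - τ j + p|}

/-- The (even, 1-periodic) function `h_ℓ(t) = |cot(πt)|^ℓ csc²(πt)`, agreeing with
`cot^ℓ(πt) csc²(πt)` on `(0, 1/2]`. -/
noncomputable def hfun (ℓ : ℕ) (t : ℝ) : ℝ :=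
  |Real.cos (π * t) / Real.sin (π * t)| ^ ℓ * (1 / Real.sin (π * t)) ^ 2

lemma hfun_neg (ℓ : ℕ) (t : ℝ) : hfun ℓ (-t) = hfun ℓ t := by
  simp [hfun, div_neg]

lemma hfun_abs (ℓ : ℕ) (t : ℝ) : hfun ℓ |t| = hfun ℓ t := by
  rcases abs_choice t with h | h <;> rw [h]
  exact hfun_neg ℓ t

lemma hfun_sub_intCast (ℓ : ℕ) (t : ℝ) (m : ℤ) : hfun ℓ (t - m) = hfun ℓ t := by
  have h : π * (t - m) = π * t - m * π := by ring
  rw [hfun, hfun, h, Real.sin_sub_int_mul_pi, Real.cos_sub_int_mul_pi]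
  rcases Int.even_or_odd m with hm | hm
  · simp [hm.neg_one_zpow]
  · simp [hm.neg_one_zpow]

lemma hfun_le_hfun (ℓ : ℕ) {a b : ℝ} (ha : 0 < a) (hab : a ≤ b) (hb : b ≤ 1 - a) :
    hfun ℓ b ≤ hfun ℓ a := by
  have hπ := Real.pi_pos
  have hsa : 0 < sin (π * a) := Real.sin_pos_of_pos_of_lt_pi (by positivity) (by nlinarith)
  have hsb : sin (π * a) ≤ sin (π * b) := by
    rcases le_total b (1 / 2) with h | h
    · exact Real.sin_le_sin_of_le_of_le_pi_div_two (by nlinarith) (by nlinarith) (by nlinarith)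
    · rw [← Real.sin_pi_sub (π * b)]
      exact Real.sin_le_sin_of_le_of_le_pi_div_two (by nlinarith) (by nlinarith) (by nlinarith)
  have hc : |cos (π * b)| ≤ |cos (π * a)| := by
    rw [← sq_le_sq]
    nlinarith [Real.sin_sq_add_cos_sq (π * a), Real.sin_sq_add_cos_sq (π * b)]
  rw [hfun, hfun, abs_div, abs_div, abs_of_pos hsa, abs_of_pos (hsa.trans_le hsb)]
  have hsb0 := hsa.trans_le hsb
  gcongr

lemma cos_mul_cube_le_sin_cube {x : ℝ} (h0 : 0 ≤ x) (h1 : x ≤ π / 2) :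
    cos x * x ^ 3 ≤ sin x ^ 3 := by
  have hx2 : x ≤ 2 := by linarith [Real.pi_lt_four]
  have hcos : cos x ≤ 1 - x ^ 2 / 2 + x ^ 4 / 24 := by
    have h := Real.sin_ge_sub_cube (x := x / 2) (by positivity)
    have h' : 0 ≤ x / 2 - (x / 2) ^ 3 / 6 := by
      have : 0 ≤ x * (24 - x ^ 2) := mul_nonneg h0 (by nlinarith)
      nlinarith
    have hsq := pow_le_pow_left₀ h' h 2
    have hd : cos x = 1 - 2 * sin (x / 2) ^ 2 := by
      have := Real.cos_two_mul (x / 2)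
      rw [Real.cos_sq', mul_div_cancel₀ x two_ne_zero] at this
      linarith
    nlinarith [pow_nonneg h0 6]
  have hs : 0 ≤ x - x ^ 3 / 6 := by
    have : 0 ≤ x * (6 - x ^ 2) := mul_nonneg h0 (by nlinarith)
    nlinarith
  calc cos x * x ^ 3 ≤ (1 - x ^ 2 / 2 + x ^ 4 / 24) * x ^ 3 := by gcongr
    _ ≤ (x - x ^ 3 / 6) ^ 3 := by
        have : 0 ≤ x ^ 7 * (9 - x ^ 2) := mul_nonneg (by positivity) (by nlinarith)
        nlinarith
    _ ≤ sin x ^ 3 := pow_le_pow_left₀ hs (Real.sin_ge_sub_cube h0) 3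

lemma hfun_le_one_div_pow {ℓ : ℕ} (h1 : 1 ≤ ℓ) (h2 : ℓ ≤ 2) {t : ℝ} (ht0 : 0 < t)
    (ht : t ≤ 1 / 2) : hfun ℓ t ≤ 1 / (π * t) ^ (ℓ + 2) := by
  have hπ := Real.pi_pos
  have hx0 : 0 < π * t := by positivity
  have hx1 : π * t ≤ π / 2 := by nlinarith
  rw [hfun]
  generalize π * t = x at hx0 hx1 ⊢
  have hs : 0 < sin x := Real.sin_pos_of_pos_of_lt_pi hx0 (by linarith)
  have hc : 0 ≤ cos x := Real.cos_nonneg_of_mem_Icc ⟨by linarith, hx1⟩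
  have hcube := cos_mul_cube_le_sin_cube hx0.le hx1
  rw [abs_of_nonneg (by positivity), div_pow, div_pow, one_pow, div_mul_div_comm, mul_one,
    ← pow_add, div_le_div_iff₀ (by positivity) (by positivity), one_mul]
  interval_cases ℓ
  · simpa using hcube
  · have hsq := pow_le_pow_left₀ (by positivity) hcube 2
    have hle : sin x ^ 2 ≤ x ^ 2 := pow_le_pow_left₀ hs.le (Real.sin_le hx0.le) 2
    refine le_of_mul_le_mul_right ?_ (pow_pos hx0 2)
    calc cos x ^ 2 * x ^ (2 + 2) * x ^ 2 = (cos x * x ^ 3) ^ 2 := by ring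
      _ ≤ (sin x ^ 3) ^ 2 := hsq
      _ = sin x ^ (2 + 2) * sin x ^ 2 := by ring
      _ ≤ sin x ^ (2 + 2) * x ^ 2 := by gcongr

/-- The midpoint estimate for `∫ z in y - 1/2..y + 1/2, 1 / z ^ (ℓ + 2)`. -/
lemma one_div_pow_le_sub {ℓ : ℕ} (h1 : 1 ≤ ℓ) (h2 : ℓ ≤ 2) {y : ℝ} (hy : 1 / 2 < y) :
    1 / y ^ (ℓ + 2) ≤
      1 / ((ℓ + 1) * (y - 1 / 2) ^ (ℓ + 1)) - 1 / ((ℓ + 1) * (y + 1 / 2) ^ (ℓ + 1)) := by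
  have ha : 0 < y - 1 / 2 := by linarith
  have hb : 0 < y + 1 / 2 := by linarith
  have hy0 : 0 < y := by linarith
  have hq : 0 < y ^ 2 - 1 / 4 := by nlinarith
  have hq' : y ^ 2 - 1 / 4 ≤ y ^ 2 := by linarith
  rw [div_sub_div _ _ (by positivity) (by positivity),
    div_le_div_iff₀ (by positivity) (by positivity)]
  interval_cases ℓ
  · have h := pow_le_pow_left₀ hq.le hq' 2
    norm_num
    nlinarith
  · have h := pow_le_pow_left₀ hq.le hq' 3
    norm_num
    nlinarith [pow_pos hy0 4]

lemma sum_hfun_le_of_one_le {ℓ : ℕ} (h1 : 1 ≤ ℓ) (h2 : ℓ ≤ 2) {D d : ℝ} (hd0 : 0 ≤ d)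
    (hd : 2 * d < D) {K : ℕ} (hK : K * D ≤ 1 / 2) :
    ∑ k ∈ Finset.range K, hfun ℓ ((k + 1) * D - d) ≤
      1 / (π * D) ^ (ℓ + 2) * (1 / ((ℓ + 1) * (1 / 2 - d / D) ^ (ℓ + 1))) := by
  have hπ := Real.pi_pos
  have hD : 0 < D := by linarith
  have hc : d / D < 1 / 2 := by rw [div_lt_iff₀ hD]; linarith
  set c := d / D with hcdef
  have hdc : d = c * D := by rw [hcdef]; field_simp
  set F : ℕ → ℝ := fun k => 1 / ((ℓ + 1) * (k + 1 / 2 - c) ^ (ℓ + 1)) with hF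
  have hterm : ∀ k ∈ Finset.range K,
      hfun ℓ ((k + 1) * D - d) ≤ 1 / (π * D) ^ (ℓ + 2) * (F k - F (k + 1)) := by
    intro k hk
    have hkK : (k : ℝ) + 1 ≤ K := by exact_mod_cast Finset.mem_range.1 hk
    have hk0 : (0 : ℝ) ≤ k := k.cast_nonneg
    refine (hfun_le_one_div_pow h1 h2 (by nlinarith) (by nlinarith)).trans ?_
    have hmid := one_div_pow_le_sub h1 h2 (y := k + 1 - c) (by linarith)
    have heq : π * ((k + 1) * D - d) = π * D * (k + 1 - c) := by rw [hdc]; ring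
    have hsucc : (k : ℝ) + 1 - c + 1 / 2 = (k + 1 : ℕ) + 1 / 2 - c := by push_cast; ring
    have hpred : (k : ℝ) + 1 - c - 1 / 2 = k + 1 / 2 - c := by ring
    rw [hsucc, hpred] at hmid
    rw [heq, mul_pow, ← one_div_mul_one_div]
    exact mul_le_mul_of_nonneg_left hmid (by positivity)
  refine (Finset.sum_le_sum hterm).trans ?_
  rw [← Finset.mul_sum, Finset.sum_range_sub']
  have : 0 ≤ F K := by
    have : (0 : ℝ) ≤ K + 1 / 2 - c := by linarith [K.cast_nonneg (α := ℝ)]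
    positivity
  gcongr
  simp only [hF] at this ⊢
  simpa using this

/-- The midpoint estimate for `∫ z in x - w/2..x + w/2, 1 / sin z ^ 2`. -/
lemma one_div_sin_sq_le_cot_sub {x w : ℝ} (hw : 0 < w) (hw' : w < π) (h0 : 0 < x - w / 2)
    (h1 : x + w / 2 < π) :
    (1 / sin x) ^ 2 ≤ 1 / w * (cos (x - w / 2) / sin (x - w / 2)
      - cos (x + w / 2) / sin (x + w / 2)) := by
  have hs1 : 0 < sin (x - w / 2) := Real.sin_pos_of_pos_of_lt_pi h0 (by linarith)
  have hs2 : 0 < sin (x + w / 2) := Real.sin_pos_of_pos_of_lt_pi (by linarith) h1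
  have hs : 0 < sin x := Real.sin_pos_of_pos_of_lt_pi (by linarith) (by linarith)
  have hv : 0 < cos (w / 2) := Real.cos_pos_of_mem_Ioo ⟨by linarith, by linarith⟩
  have htan : w / 2 * cos (w / 2) ≤ sin (w / 2) := by
    have := Real.le_tan (x := w / 2) (by positivity) (by linarith)
    rwa [Real.tan_eq_sin_div_cos, le_div_iff₀ hv] at this
  have hnum : cos (x - w / 2) * sin (x + w / 2) - sin (x - w / 2) * cos (x + w / 2)
      = 2 * sin (w / 2) * cos (w / 2) := by
    rw [← Real.sin_two_mul, show 2 * (w / 2) = (x + w / 2) - (x - w / 2) by ring,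
      Real.sin_sub (x + w / 2)]
    ring
  have hden : sin (x - w / 2) * sin (x + w / 2) = sin x ^ 2 - sin (w / 2) ^ 2 := by
    rw [Real.sin_sub, Real.sin_add]
    linear_combination sin x ^ 2 * Real.cos_sq' (w / 2) - sin (w / 2) ^ 2 * Real.cos_sq' x
  rw [div_sub_div _ _ hs1.ne' hs2.ne', hnum, one_div_mul_eq_div, div_div, one_div_pow,
    div_le_div_iff₀ (by positivity) (by positivity), hden]
  have hx1 := Real.sin_sq_le_one x
  have hprod := mul_le_mul_of_nonneg_left htan hv.le
  have hvu := Real.sin_sq_add_cos_sq (w / 2)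
  have key : w * (sin x ^ 2 - sin (w / 2) ^ 2) ≤ w * (sin x ^ 2 * cos (w / 2) ^ 2) := by
    gcongr
    nlinarith [sq_nonneg (sin (w / 2))]
  nlinarith [sq_nonneg (sin x)]

lemma sum_hfun_zero_le {D d : ℝ} (hd0 : 0 ≤ d) (hd : 2 * d < D) (hD2 : D ≤ 1 / 2) {K : ℕ}
    (hK : K * D ≤ 1 / 2) :
    ∑ k ∈ Finset.range K, hfun 0 ((k + 1) * D - d) ≤
      1 / (π * D) * (cos (π * (D / 2 - d)) / sin (π * (D / 2 - d))
        - cos (π * ((K + 1 / 2) * D - d)) / sin (π * ((K + 1 / 2) * D - d))) := by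
  have hπ := Real.pi_pos
  have hD : 0 < D := by linarith
  set F : ℕ → ℝ := fun k =>
    cos (π * ((k + 1 / 2) * D - d)) / sin (π * ((k + 1 / 2) * D - d)) with hF
  have hterm : ∀ k ∈ Finset.range K,
      hfun 0 ((k + 1) * D - d) ≤ 1 / (π * D) * (F k - F (k + 1)) := by
    intro k hk
    have hkK : (k : ℝ) + 1 ≤ K := by exact_mod_cast Finset.mem_range.1 hk
    have hk0 : (0 : ℝ) ≤ k := k.cast_nonneg
    have e1 : π * ((k + 1) * D - d) - π * D / 2 = π * ((k + 1 / 2) * D - d) := by ring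
    have e2 : π * ((k + 1) * D - d) + π * D / 2 = π * (((k + 1 : ℕ) + 1 / 2) * D - d) := by
      push_cast; ring
    have h := one_div_sin_sq_le_cot_sub (x := π * ((k + 1) * D - d)) (w := π * D)
      (by positivity) (by nlinarith) (by rw [e1]; exact mul_pos hπ (by nlinarith))
      (by
        have : (k + 1) * D - d + D / 2 < 1 := by nlinarith
        nlinarith)
    rw [e1, e2] at h
    simpa only [hfun, pow_zero, one_mul] using h
  refine (Finset.sum_le_sum hterm).trans_eq ?_
  rw [← Finset.mul_sum, Finset.sum_range_sub']
  simp only [hF]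
  congr 6 <;> norm_num <;> ring

lemma cot_add_cot_nonneg {x y : ℝ} (hx : 0 < x) (hy : 0 < y) (hxy : x + y ≤ π) :
    0 ≤ cos x / sin x + cos y / sin y := by
  have hsx : 0 < sin x := Real.sin_pos_of_pos_of_lt_pi hx (by linarith)
  have hsy : 0 < sin y := Real.sin_pos_of_pos_of_lt_pi hy (by linarith)
  have hs : 0 ≤ sin (x + y) := Real.sin_nonneg_of_nonneg_of_le_pi (by linarith) hxy
  rw [div_add_div _ _ hsx.ne' hsy.ne']
  refine div_nonneg ?_ (by positivity)
  rw [Real.sin_add] at hs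
  linarith

lemma cot_le_one_div {x : ℝ} (h0 : 0 < x) (h1 : x < π / 2) : cos x / sin x ≤ 1 / x := by
  have hs : 0 < sin x := Real.sin_pos_of_pos_of_lt_pi h0 (by linarith)
  have hc : 0 < cos x := Real.cos_pos_of_mem_Ioo ⟨by linarith, h1⟩
  have := Real.le_tan h0.le h1
  rw [Real.tan_eq_sin_div_cos, le_div_iff₀ hc] at this
  rw [div_le_div_iff₀ hs h0]
  linarith

lemma sum_hfun_add_sum_hfun_le {ℓ : ℕ} (hℓ : ℓ ≤ 2) {D d : ℝ} (hd0 : 0 ≤ d) (hd : 2 * d < D)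
    (hD2 : D ≤ 1 / 2) {K L : ℕ} (hK : K * D ≤ 1 / 2) (hL : L * D ≤ 1 / 2)
    (hKL : (K + L + 1) * D ≤ 1) :
    ∑ k ∈ Finset.range K, hfun ℓ ((k + 1) * D - d) + ∑ k ∈ Finset.range L, hfun ℓ ((k + 1) * D - d)
      ≤ (2 / (π * D)) ^ (ℓ + 2) * (1 / ((ℓ + 1) * (1 - 2 * (d / D)) ^ (ℓ + 1))) := by
  have hπ := Real.pi_pos
  have hD : 0 < D := by linarith
  have hc : d / D < 1 / 2 := by rw [div_lt_iff₀ hD]; linarith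
  have hc' : 0 < 1 - 2 * (d / D) := by linarith
  rcases Nat.eq_zero_or_pos ℓ with rfl | h1
  · have hcot := cot_add_cot_nonneg (x := π * ((K + 1 / 2) * D - d))
      (y := π * ((L + 1 / 2) * D - d))
      (mul_pos hπ (by nlinarith [K.cast_nonneg (α := ℝ)]))
      (mul_pos hπ (by nlinarith [L.cast_nonneg (α := ℝ)]))
      (by nlinarith)
    have hfirst := cot_le_one_div (x := π * (D / 2 - d)) (mul_pos hπ (by linarith))
      (by nlinarith)
    have h := add_le_add (sum_hfun_zero_le hd0 hd hD2 hK) (sum_hfun_zero_le hd0 hd hD2 hL)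
    rw [← mul_add] at h
    have heq : (2 / (π * D)) ^ (0 + 2) * (1 / (((0 : ℕ) + 1) * (1 - 2 * (d / D)) ^ (0 + 1)))
        = 1 / (π * D) * (2 * (1 / (π * (D / 2 - d)))) := by
      have : D - 2 * d ≠ 0 := by linarith
      have : D / 2 - d ≠ 0 := by intro h; apply this; linarith
      have : 1 - 2 * (d / D) = 2 * (D / 2 - d) / D := by field_simp
      rw [this]
      push_cast
      field_simp
      norm_num
    rw [heq]
    refine h.trans ?_
    gcongr
    linarith
  · have h := add_le_add (sum_hfun_le_of_one_le h1 hℓ hd0 hd hK)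
      (sum_hfun_le_of_one_le h1 hℓ hd0 hd hL)
    refine h.trans_eq ?_
    have : 1 - 2 * (d / D) = 2 * (1 / 2 - d / D) := by ring
    have h3 : 1 / 2 - d / D ≠ 0 := by linarith
    rw [this, mul_pow, div_pow]
    generalize 1 / 2 - d / D = z at h3
    field_simp
    ring

lemma card_add_one_mul_le_of_separated {ι : Type*} [DecidableEq ι] {D : ℝ} (x : ι → ℝ)
    (S : Finset ι) (h1 : ∀ j ∈ S, D ≤ x j)
    (hS : ∀ j ∈ S, ∀ k ∈ S, j ≠ k → D ≤ |x j - x k|) {B : ℝ} (hB : D ≤ B)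
    (hSB : ∀ j ∈ S, x j + D ≤ B) : ((S.card : ℝ) + 1) * D ≤ B := by
  induction S using Finset.induction_on_max_value x generalizing B with
  | empty => simpa using hB
  | insert a s has hmax ih =>
    simp only [Finset.forall_mem_insert] at h1 hSB
    have := ih h1.2 (fun j hj k hk => hS j (Finset.mem_insert_of_mem hj) k
      (Finset.mem_insert_of_mem hk)) h1.1 (fun j hj => by
        have := hS a (Finset.mem_insert_self a s) j (Finset.mem_insert_of_mem hj)
          (fun h => has (h ▸ hj))
        rw [abs_of_nonneg (sub_nonneg.2 (hmax j hj))] at this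
        linarith)
    rw [Finset.card_insert_of_notMem has]
    push_cast
    linarith [hSB.1]

lemma sum_le_sum_range_of_separated {ι : Type*} [DecidableEq ι] {D M : ℝ} (hD : 0 ≤ D)
    {f : ℝ → ℝ} (hf : AntitoneOn f (Set.Icc D M)) (x : ι → ℝ)
    (S : Finset ι) (hx : ∀ j ∈ S, x j ∈ Set.Icc D M)
    (hS : ∀ j ∈ S, ∀ k ∈ S, j ≠ k → D ≤ |x j - x k|) :
    ∑ j ∈ S, f (x j) ≤ ∑ k ∈ Finset.range S.card, f ((k + 1) * D) := by
  induction S using Finset.induction_on_max_value x with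
  | empty => simp
  | insert a s has hmax ih =>
    simp only [Finset.forall_mem_insert] at hx
    have hs : ∀ j ∈ s, ∀ k ∈ s, j ≠ k → D ≤ |x j - x k| := fun j hj k hk =>
      hS j (Finset.mem_insert_of_mem hj) k (Finset.mem_insert_of_mem hk)
    have hcard := card_add_one_mul_le_of_separated x s (fun j hj => (hx.2 j hj).1) hs hx.1.1
      (fun j hj => by
        have := hS a (Finset.mem_insert_self a s) j (Finset.mem_insert_of_mem hj)
          (fun h => has (h ▸ hj))
        rw [abs_of_nonneg (sub_nonneg.2 (hmax j hj))] at this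
        linarith)
    rw [Finset.card_insert_of_notMem has, Finset.sum_insert has, Finset.sum_range_succ, add_comm]
    refine add_le_add (ih hx.2 hs) (hf ⟨?_, hcard.trans hx.1.2⟩ hx.1 hcard)
    nlinarith [s.card.cast_nonneg (α := ℝ)]

lemma sep_le {r : ℕ} (τ : Fin r → ℝ) {i j : Fin r} (hij : i ≠ j) (p : ℤ) :
    sep τ ≤ |τ i - τ j + p| :=
  csInf_le ⟨0, by rintro _ ⟨_, _, _, _, rfl⟩; positivity⟩ ⟨i, j, p, hij, rfl⟩

lemma sep_le_half {r : ℕ} (τ : Fin r → ℝ) : sep τ ≤ 1 / 2 := by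
  by_cases h : ∃ i j : Fin r, i ≠ j
  · obtain ⟨i, j, hij⟩ := h
    have := sep_le τ hij (-round (τ i - τ j))
    push_cast [← sub_eq_add_neg] at this
    exact this.trans (abs_sub_round _)
  · push Not at h
    have : {d : ℝ | ∃ (i j : Fin r) (p : ℤ), i ≠ j ∧ d = |τ i - τ j + p|} = ∅ := by
      refine Set.eq_empty_of_forall_notMem ?_
      rintro d ⟨j, k, -, hjk, -⟩
      exact hjk (h j k)
    rw [sep, this, Real.sInf_empty]
    norm_num

lemma hfun_add_le (ℓ : ℕ) {v u d : ℝ} (hu : |u| ≤ d) (hd : d < |v - round v|) :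
    hfun ℓ (v + u) ≤ hfun ℓ (|v - round v| - d) := by
  have hr := abs_sub_round v
  rw [← hfun_sub_intCast ℓ (v + u) (round v), ← hfun_abs,
    show v + u - round v = v - round v + u by ring]
  refine hfun_le_hfun ℓ (by linarith) ?_ ?_
  · have := abs_sub_abs_le_abs_sub (v - round v) (-u)
    rw [abs_neg, sub_neg_eq_add] at this
    linarith
  · linarith [abs_add_le (v - round v) u]

theorem sum_hfun_le (n r : ℕ) (hn : 2 ≤ n) (ℓ : ℕ) (hℓ : ℓ ≤ 2)
    (τ : Fin r → ℝ) (α β : ℝ) (hα : 0 < α) (hsep : α ≤ ((n : ℝ) + 1) * sep τ)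
    (u : Fin r → Fin r → ℝ) (hu0 : ∀ i, u i i = 0)
    (hu : ∀ i j, ((n : ℝ) + 1) * |u i j| ≤ β) (hβ : β < α / 2) (i : Fin r) :
    ∑ j ∈ Finset.univ.erase i, hfun ℓ (τ j - τ i + u i j) ≤
      (2 / (π * sep τ)) ^ (ℓ + 2) * (1 / ((ℓ + 1) * (1 - 2 * β / α) ^ (ℓ + 1))) := by
  have hn0 : (0 : ℝ) < n + 1 := by positivity
  have hβ0 : 0 ≤ β := by simpa [hu0] using hu i i
  have hD2 := sep_le_half τ
  have hle := fun {j k : Fin r} => sep_le τ (i := j) (j := k)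
  set D := sep τ
  have hD : 0 < D := pos_of_mul_pos_right (hα.trans_le hsep) hn0.le
  set d := β / (n + 1) with hd
  have hd0 : 0 ≤ d := by positivity
  have hnd : (n + 1) * d = β := by rw [hd]; field_simp
  have hdD : 2 * d < D := by nlinarith
  have hud (j : Fin r) : |u i j| ≤ d := by rw [hd, le_div_iff₀ hn0]; linarith [hu i j]
  set f : Fin r → ℝ := fun j => τ j - τ i - round (τ j - τ i) with hf
  have hf_half (j : Fin r) : |f j| ≤ 1 / 2 := abs_sub_round _
  have hf_sep {j : Fin r} (hj : j ≠ i) : D ≤ |f j| := by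
    simpa [hf, sub_eq_add_neg] using hle hj (-round (τ j - τ i))
  have hff_sep {j k : Fin r} (hjk : j ≠ k) (m : ℤ) : D ≤ |f j - f k + m| := by
    have := hle hjk (round (τ k - τ i) - round (τ j - τ i) + m)
    push_cast at this
    refine this.trans_eq (congrArg _ ?_)
    simp only [hf]
    ring
  have habs_sep {j k : Fin r} (hjk : j ≠ k) (h : 0 ≤ f j ↔ 0 ≤ f k) :
      D ≤ |(|f j| - |f k|)| := by
    have := hff_sep hjk 0
    rw [Int.cast_zero, add_zero] at this
    by_cases hj : 0 ≤ f j
    · rwa [abs_of_nonneg hj, abs_of_nonneg (h.1 hj)]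
    · have hk : ¬ 0 ≤ f k := fun hk => hj (h.2 hk)
      rwa [abs_of_neg (not_le.1 hj), abs_of_neg (not_le.1 hk), ← neg_sub', abs_neg]
  set P := (Finset.univ.erase i).filter fun j => 0 ≤ f j
  set N := (Finset.univ.erase i).filter fun j => ¬ 0 ≤ f j
  have hP {j : Fin r} (hj : j ∈ P) : j ≠ i ∧ 0 ≤ f j := by simpa [P] using hj
  have hN {j : Fin r} (hj : j ∈ N) : j ≠ i ∧ f j < 0 := by simpa [N] using hj
  have hP_sep : ∀ j ∈ P, ∀ k ∈ P, j ≠ k → D ≤ |(|f j| - |f k|)| := fun j hj k hk hjk =>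
    habs_sep hjk (iff_of_true (hP hj).2 (hP hk).2)
  have hN_sep : ∀ j ∈ N, ∀ k ∈ N, j ≠ k → D ≤ |(|f j| - |f k|)| := fun j hj k hk hjk =>
    habs_sep hjk (iff_of_false (hN hj).2.not_ge (hN hk).2.not_ge)
  have hPN {j k : Fin r} (hj : j ∈ P) (hk : k ∈ N) : |f j| + |f k| + D ≤ 1 := by
    have hj' := (hP hj).2
    have hk' := (hN hk).2
    have hjk : j ≠ k := by rintro rfl; linarith
    have h := hff_sep hjk (-1)
    have hj2 := hf_half j
    have hk2 := hf_half k
    rw [abs_of_nonneg hj'] at hj2 ⊢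
    rw [abs_of_neg hk'] at hk2 ⊢
    rw [abs_of_nonpos (by push_cast; linarith)] at h
    push_cast at h
    linarith
  have hP_card {B : ℝ} := card_add_one_mul_le_of_separated (B := B) (fun j => |f j|) P
    (fun j hj => hf_sep (hP hj).1) hP_sep
  have hN_card {B : ℝ} := card_add_one_mul_le_of_separated (B := B) (fun j => |f j|) N
    (fun j hj => hf_sep (hN hj).1) hN_sep
  have hK : P.card * D ≤ 1 / 2 := by
    linarith [hP_card (B := 1 / 2 + D) (by linarith) fun j _ => by linarith [hf_half j]]
  have hL : N.card * D ≤ 1 / 2 := by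
    linarith [hN_card (B := 1 / 2 + D) (by linarith) fun j _ => by linarith [hf_half j]]
  have hKL : (P.card + N.card + 1) * D ≤ 1 := by
    have h := hN_card (B := 1 - P.card * D) (by linarith) fun k hk => by
      linarith [hP_card (B := 1 - |f k|) (by linarith [hf_half k]) fun j hj => by
        linarith [hPN hj hk]]
    linarith
  have hanti : AntitoneOn (fun t => hfun ℓ (t - d)) (Set.Icc D (1 / 2)) := by
    intro a ha b hb hab
    exact hfun_le_hfun ℓ (by linarith [ha.1]) (by linarith) (by linarith [hb.2])
  calc ∑ j ∈ Finset.univ.erase i, hfun ℓ (τ j - τ i + u i j)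
      ≤ ∑ j ∈ Finset.univ.erase i, hfun ℓ (|f j| - d) := Finset.sum_le_sum fun j hj =>
        hfun_add_le ℓ (hud j) (by
          have : D ≤ |f j| := hf_sep (Finset.ne_of_mem_erase hj)
          exact lt_of_lt_of_le (by linarith) this)
    _ = ∑ j ∈ P, hfun ℓ (|f j| - d) + ∑ j ∈ N, hfun ℓ (|f j| - d) :=
        (Finset.sum_filter_add_sum_filter_not _ _ _).symm
    _ ≤ ∑ k ∈ Finset.range P.card, hfun ℓ ((k + 1) * D - d)
        + ∑ k ∈ Finset.range N.card, hfun ℓ ((k + 1) * D - d) := add_le_add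
        (sum_le_sum_range_of_separated hD.le hanti (fun j => |f j|) P
          (fun j hj => ⟨hf_sep (hP hj).1, hf_half j⟩) hP_sep)
        (sum_le_sum_range_of_separated hD.le hanti (fun j => |f j|) N
          (fun j hj => ⟨hf_sep (hN hj).1, hf_half j⟩) hN_sep)
    _ ≤ (2 / (π * D)) ^ (ℓ + 2) * (1 / ((ℓ + 1) * (1 - 2 * (d / D)) ^ (ℓ + 1))) :=
        sum_hfun_add_sum_hfun_le hℓ hd0 hdD hD2 hK hL hKL
    _ ≤ (2 / (π * D)) ^ (ℓ + 2) * (1 / ((ℓ + 1) * (1 - 2 * β / α) ^ (ℓ + 1))) := by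
        have hratio : d / D ≤ β / α := by
          rw [hd, div_div]
          exact div_le_div_of_nonneg_left hβ0 hα hsep
        have hpos : 0 < 1 - 2 * β / α := by
          rw [sub_pos, div_lt_one hα]
          linarith
        have hle' : 1 - 2 * β / α ≤ 1 - 2 * (d / D) := by
          rw [mul_div_assoc]
          linarith
        gcongr
end

section
/- Suppose n ≥ 2 and τ_1,…,τ_r ∈ 𝕋 satisfy (n+1)Δ(τ) ≥ α for some α > 0, and let u_{i,j} be reals with (n+1) max_{i≠j}|u_{i,j}| = β < α/2. Then for every i, ∑_{j≠i} |F_N''(τ_j − τ_i + u_{i,j})| ≤ C_2 (n+1)² ((n+1)Δ(τ))^{-2}, with C_2 = ((80/9)(α−2β)^{-1} + (16/π)(α−2β)^{-2} + (64/(3π²))(α−2β)^{-3}) α. -/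
open Real

/-- The normalized Fejér kernel of order `N = 2n+1`:
`F_N(t) = (1/(n+1)) ∑_{k=-n}^{n} (1 - |k|/(n+1)) e^{i2πkt}`, written in its real (cosine) form. -/
noncomputable def fejer (n : ℕ) (t : ℝ) : ℝ :=
  (1 / (n + 1)) * ∑ k ∈ Finset.Icc (-(n : ℤ)) n, (1 - |(k : ℝ)| / (n + 1)) * Real.cos (2 * π * k * t)

/-! ### Elementary trigonometric inequalities -/

lemma mul_cos_le_sin {x : ℝ} (h0 : 0 ≤ x) (h1 : x ≤ π / 2) : x * cos x ≤ sin x := by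
  rcases h1.eq_or_lt with rfl | h1
  · simp
  · have hc : 0 < cos x := cos_pos_of_mem_Ioo ⟨by linarith [pi_pos], h1⟩
    have := le_tan h0 h1
    rwa [tan_eq_sin_div_cos, le_div_iff₀ hc] at this

lemma sq_mul_cos_sq_le_sin_sq {x : ℝ} (h : |x| ≤ π / 2) : x ^ 2 * cos x ^ 2 ≤ sin x ^ 2 := by
  have hc : 0 ≤ cos |x| := cos_nonneg_of_mem_Icc ⟨by linarith [abs_nonneg x, pi_pos], h⟩
  have h1 := mul_cos_le_sin (abs_nonneg x) h
  have h2 : (|x| * cos |x|) ^ 2 ≤ sin |x| ^ 2 := by gcongr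
  rw [mul_pow, sq_abs, cos_abs, sin_sq, cos_abs, ← sin_sq] at h2
  exact h2

lemma abs_cos_mul_cube_le {x : ℝ} (h : |x| ≤ π / 2) : |cos x| * |x| ^ 3 ≤ |sin x| ^ 3 := by
  have hc : 0 ≤ cos |x| := cos_nonneg_of_mem_Icc ⟨by linarith [abs_nonneg x, pi_pos], h⟩
  have h1 := cos_mul_cube_le_sin_cube (abs_nonneg x) h
  have h2 : |sin x| = sin |x| := by
    have hs : 0 ≤ sin |x| := sin_nonneg_of_nonneg_of_le_pi (abs_nonneg x) (by linarith [pi_pos])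
    rw [← abs_of_nonneg hs, abs_eq_abs.2]
    rcases abs_choice x with h | h <;> rw [h] <;> simp
  rw [h2, ← cos_abs x, abs_of_nonneg hc]
  exact h1

lemma cos_sq_mul_pow_four_le {x : ℝ} (h : |x| ≤ π / 2) : cos x ^ 2 * |x| ^ 4 ≤ |sin x| ^ 4 := by
  have h1 := abs_cos_mul_cube_le h
  have h2 := abs_cos_le_one x
  have h3 : |sin x| ≤ |x| := abs_sin_le_abs
  have hc := abs_nonneg (cos x)
  have hs := abs_nonneg (sin x)
  have hx := abs_nonneg x
  rcases hx.eq_or_lt with h0 | h0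
  · rw [← h0]; simp
  have key : |cos x| * |x| ^ 2 ≤ |sin x| ^ 2 := by
    refine le_of_mul_le_mul_right ?_ h0
    calc |cos x| * |x| ^ 2 * |x| = |cos x| * |x| ^ 3 := by ring
      _ ≤ |sin x| ^ 3 := h1
      _ = |sin x| ^ 2 * |sin x| := by ring
      _ ≤ |sin x| ^ 2 * |x| := by gcongr
  calc cos x ^ 2 * |x| ^ 4 = (|cos x| * |x| ^ 2) ^ 2 := by rw [← sq_abs (cos x)]; ring
    _ ≤ (|sin x| ^ 2) ^ 2 := by gcongr
    _ = _ := by ring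

lemma abs_sin_pi_mul_add_int (t : ℝ) (k : ℤ) : |sin (π * (t + k))| = |sin (π * t)| := by
  rw [mul_add, mul_comm π (k : ℝ), sin_add_int_mul_pi, abs_mul, abs_zpow]
  simp

lemma abs_cos_pi_mul_add_int (t : ℝ) (k : ℤ) : |cos (π * (t + k))| = |cos (π * t)| := by
  rw [mul_add, mul_comm π (k : ℝ), cos_add_int_mul_pi, abs_mul, abs_zpow]
  simp

/-- A finite form of the partial fraction expansion of `1 / sin ^ 2`. -/
lemma exists_one_div_sin_sq_le (p : ℕ) (t : ℝ) (ht : sin (π * t) ≠ 0) :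
    ∃ K : Finset ℤ, 1 / sin (π * t) ^ 2 ≤ ∑ k ∈ K, 1 / (π * (t + k)) ^ 2 + (1 / 2) ^ p := by
  induction p generalizing t with
  | zero =>
    refine ⟨{-round t}, ?_⟩
    simp only [Finset.sum_singleton, pow_zero]
    have hr : |t + (-round t : ℤ)| ≤ 1 / 2 := by
      simpa [sub_eq_add_neg] using abs_sub_round t
    have hs : sin (π * (t + (-round t : ℤ))) ^ 2 = sin (π * t) ^ 2 := by
      rw [← sq_abs, abs_sin_pi_mul_add_int, sq_abs]
    have hb := sq_mul_cos_sq_le_sin_sq (x := π * (t + (-round t : ℤ)))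
      (by rw [abs_mul, abs_of_pos pi_pos]; nlinarith [pi_pos])
    have hpos : 0 < sin (π * t) ^ 2 := by positivity
    rw [cos_sq', hs] at hb
    set y := π * (t + (-round t : ℤ)) with hy
    have hy0 : y ≠ 0 := by
      intro h0
      rw [h0] at hs
      simp at hs
      exact ht (pow_eq_zero_iff two_ne_zero |>.1 hs.symm)
    rw [div_add_one (by positivity), div_le_div_iff₀ hpos (by positivity)]
    nlinarith
  | succ p ih =>
    have hd : sin (π * t) = 2 * sin (π * (t / 2)) * cos (π * (t / 2)) := by
      rw [← sin_two_mul]; ring_nf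
    have hc : sin (π * ((t + 1) / 2)) = cos (π * (t / 2)) := by
      rw [← sin_add_pi_div_two]; ring_nf
    have hs0 : sin (π * (t / 2)) ≠ 0 := fun h => ht (by rw [hd, h]; simp)
    have hc0 : cos (π * (t / 2)) ≠ 0 := fun h => ht (by rw [hd, h]; simp)
    obtain ⟨K₁, h₁⟩ := ih (t / 2) hs0
    obtain ⟨K₂, h₂⟩ := ih ((t + 1) / 2) (by rwa [hc])
    rw [hc] at h₂
    have hsplit : 1 / sin (π * t) ^ 2 =
        (1 / sin (π * (t / 2)) ^ 2 + 1 / cos (π * (t / 2)) ^ 2) / 4 := by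
      have h1 := sin_sq_add_cos_sq (π * (t / 2))
      rw [hd]
      generalize sin (π * (t / 2)) = s at *
      generalize cos (π * (t / 2)) = c at *
      field_simp
      linarith
    refine ⟨K₁.image (fun k => 2 * k) ∪ K₂.image (fun k => 2 * k + 1), ?_⟩
    rw [Finset.sum_union, Finset.sum_image (fun a _ b _ h => by simpa using h),
      Finset.sum_image (fun a _ b _ h => by simpa using h)]
    · have e₁ : ∑ k ∈ K₁, 1 / (π * (t + ((2 * k : ℤ) : ℝ))) ^ 2 =
          (∑ k ∈ K₁, 1 / (π * (t / 2 + k)) ^ 2) / 4 := by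
        rw [Finset.sum_div]
        refine Finset.sum_congr rfl fun k _ => ?_
        rw [div_div]; push_cast; ring_nf
      have e₂ : ∑ k ∈ K₂, 1 / (π * (t + ((2 * k + 1 : ℤ) : ℝ))) ^ 2 =
          (∑ k ∈ K₂, 1 / (π * ((t + 1) / 2 + k)) ^ 2) / 4 := by
        rw [Finset.sum_div]
        refine Finset.sum_congr rfl fun k _ => ?_
        rw [div_div]; push_cast; ring_nf
      rw [e₁, e₂, hsplit, pow_succ (1 / 2 : ℝ)]
      linarith
    · rw [Finset.disjoint_left]
      intro a ha hb
      simp only [Finset.mem_image] at ha hb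
      obtain ⟨x, -, hx⟩ := ha
      obtain ⟨y, -, hy⟩ := hb
      omega

/-! ### Sums over separated points -/

lemma sum_range_le_of_midpoint {g G : ℝ → ℝ} {δ β : ℝ} (hδ : 0 < δ) (hβ : 2 * β < δ)
    (hG : ∀ y, 0 < y → 0 ≤ G y)
    (hgG : ∀ y, δ / 2 < y → δ * g y ≤ G (y - δ / 2) - G (y + δ / 2)) (K : ℕ) :
    δ * ∑ m ∈ Finset.range K, g ((m + 1) * δ - β) ≤ G (δ / 2 - β) := by
  have key : δ * ∑ m ∈ Finset.range K, g ((m + 1) * δ - β) ≤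
      G (δ / 2 - β) - G ((K + 1 / 2) * δ - β) := by
    induction K with
    | zero => simp; ring_nf; rfl
    | succ K ih =>
      have hK : 0 ≤ (K : ℝ) * δ := by positivity
      have := hgG ((K + 1) * δ - β) (by nlinarith)
      rw [Finset.sum_range_succ, mul_add]
      have e₁ : ((K : ℝ) + 1) * δ - β - δ / 2 = (K + 1 / 2) * δ - β := by ring
      have e₂ : ((K : ℝ) + 1) * δ - β + δ / 2 = ((K + 1 : ℕ) + 1 / 2) * δ - β := by
        push_cast; ring
      rw [e₁, e₂] at this
      linarith
  have hK : 0 ≤ (K : ℝ) * δ := by positivity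
  linarith [hG ((K + 1 / 2) * δ - β) (by nlinarith)]

lemma sum_le_of_separated_pos {ι : Type*} {g G : ℝ → ℝ} {δ β : ℝ} (hδ : 0 < δ)
    (hβ : 2 * β < δ) (hg : ∀ y, 0 < y → 0 ≤ g y) (hanti : ∀ y z, 0 < y → y ≤ z → g z ≤ g y)
    (hG : ∀ y, 0 < y → 0 ≤ G y)
    (hgG : ∀ y, δ / 2 < y → δ * g y ≤ G (y - δ / 2) - G (y + δ / 2))
    (S : Finset ι) (v w : ι → ℝ) (hv : ∀ a ∈ S, δ ≤ v a) (hw : ∀ a ∈ S, v a - β ≤ w a)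
    (hsep : ∀ a ∈ S, ∀ b ∈ S, a ≠ b → δ ≤ |v a - v b|) :
    δ * ∑ a ∈ S, g (w a) ≤ G (δ / 2 - β) := by
  set m : ι → ℕ := fun a => ⌊v a / δ⌋₊ - 1 with hm
  have hfl : ∀ a ∈ S, ((m a : ℝ) + 1) * δ ≤ v a ∧ v a < ((m a : ℝ) + 2) * δ := by
    intro a ha
    have h1 : 1 ≤ ⌊v a / δ⌋₊ := Nat.one_le_floor_iff _ |>.2 ((one_le_div hδ).2 (hv a ha))
    have h2 : (m a : ℝ) = (⌊v a / δ⌋₊ : ℝ) - 1 := by simp only [hm]; push_cast [h1]; ring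
    have h3 : (⌊v a / δ⌋₊ : ℝ) ≤ v a / δ :=
      Nat.floor_le (div_nonneg (hδ.le.trans (hv a ha)) hδ.le)
    have h4 := Nat.lt_floor_add_one (v a / δ)
    rw [le_div_iff₀ hδ] at h3
    rw [div_lt_iff₀ hδ] at h4
    rw [h2]
    constructor <;> nlinarith
  have hinj : Set.InjOn m S := by
    intro a ha b hb hab
    by_contra hne
    have h := hsep a ha b hb hne
    obtain ⟨h1, h2⟩ := hfl a ha
    obtain ⟨h3, h4⟩ := hfl b hb
    rw [hab] at h1 h2
    have : |v a - v b| < δ := abs_lt.2 ⟨by nlinarith, by nlinarith⟩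
    linarith
  have hpos : ∀ k : ℕ, 0 < ((k : ℝ) + 1) * δ - β := fun k => by
    have : 0 ≤ (k : ℝ) * δ := by positivity
    nlinarith
  obtain ⟨K, hK⟩ : ∃ K, S.image m ⊆ Finset.range K := (S.image m).exists_nat_subset_range
  refine le_trans ?_ (sum_range_le_of_midpoint hδ hβ hG hgG K)
  gcongr
  calc ∑ a ∈ S, g (w a) ≤ ∑ a ∈ S, g (((m a : ℕ) + 1) * δ - β) := by
        refine Finset.sum_le_sum fun a ha => hanti _ _ (hpos _) ?_
        linarith [(hfl a ha).1, hw a ha]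
    _ = ∑ k ∈ S.image m, g ((k + 1) * δ - β) :=
        (Finset.sum_image (f := fun k : ℕ => g (((k : ℝ) + 1) * δ - β)) hinj).symm
    _ ≤ _ := Finset.sum_le_sum_of_subset_of_nonneg hK fun k _ _ => hg _ (hpos k)

lemma sum_le_of_separated {ι : Type*} {g G : ℝ → ℝ} {δ β : ℝ} (hδ : 0 < δ)
    (hβ : 2 * β < δ) (hg : ∀ y, 0 < y → 0 ≤ g y) (hanti : ∀ y z, 0 < y → y ≤ z → g z ≤ g y)
    (hG : ∀ y, 0 < y → 0 ≤ G y)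
    (hgG : ∀ y, δ / 2 < y → δ * g y ≤ G (y - δ / 2) - G (y + δ / 2))
    (S : Finset ι) (v w : ι → ℝ) (hv : ∀ a ∈ S, δ ≤ |v a|) (hw : ∀ a ∈ S, |v a| - β ≤ w a)
    (hsep : ∀ a ∈ S, ∀ b ∈ S, a ≠ b → δ ≤ |v a - v b|) :
    δ * ∑ a ∈ S, g (w a) ≤ 2 * G (δ / 2 - β) := by
  classical
  rw [← Finset.sum_filter_add_sum_filter_not S (fun a => 0 < v a), mul_add, two_mul]
  refine add_le_add ?_ ?_
  · refine sum_le_of_separated_pos hδ hβ hg hanti hG hgG _ v w ?_ ?_ ?_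
    · intro a ha
      rw [Finset.mem_filter] at ha
      simpa [abs_of_pos ha.2] using hv a ha.1
    · intro a ha
      rw [Finset.mem_filter] at ha
      simpa [abs_of_pos ha.2] using hw a ha.1
    · intro a ha b hb
      exact hsep a (Finset.mem_filter.1 ha).1 b (Finset.mem_filter.1 hb).1
  · refine sum_le_of_separated_pos hδ hβ hg hanti hG hgG _ (fun a => -v a) w ?_ ?_ ?_
    · intro a ha
      rw [Finset.mem_filter] at ha
      simpa [abs_of_nonpos (not_lt.1 ha.2)] using hv a ha.1
    · intro a ha
      rw [Finset.mem_filter] at ha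
      simpa [abs_of_nonpos (not_lt.1 ha.2)] using hw a ha.1
    · intro a ha b hb hab
      have := hsep a (Finset.mem_filter.1 ha).1 b (Finset.mem_filter.1 hb).1 hab
      rw [abs_sub_comm] at this
      convert this using 2
      ring

/-! ### The Fejér kernel and its derivatives -/

lemma sum_Icc_neg_succ (f : ℤ → ℝ) (n : ℕ) :
    ∑ k ∈ Finset.Icc (-((n + 1 : ℕ) : ℤ)) ((n + 1 : ℕ) : ℤ), f k =
      f (n + 1) + f (-(n + 1)) + ∑ k ∈ Finset.Icc (-(n : ℤ)) n, f k := by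
  have : Finset.Icc (-((n + 1 : ℕ) : ℤ)) ((n + 1 : ℕ) : ℤ) =
      insert ((n : ℤ) + 1) (insert (-((n : ℤ) + 1)) (Finset.Icc (-(n : ℤ)) n)) := by
    ext k
    simp only [Finset.mem_Icc, Finset.mem_insert]
    push_cast
    omega
  rw [this, Finset.sum_insert (by simp; omega), Finset.sum_insert (by simp)]
  ring

lemma sum_cos_mul_sin (n : ℕ) (x : ℝ) :
    (∑ k ∈ Finset.Icc (-(n : ℤ)) n, cos (2 * k * x)) * sin x = sin ((2 * n + 1) * x) := by
  induction n with
  | zero => simp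
  | succ n ih =>
    rw [sum_Icc_neg_succ (fun k => cos (2 * k * x)), add_mul, ih]
    have e : cos (2 * ((-((n : ℤ) + 1) : ℤ) : ℝ) * x) = cos (2 * (((n : ℤ) + 1 : ℤ) : ℝ) * x) := by
      rw [← cos_neg]; push_cast; ring_nf
    have h1 : sin ((2 * ((n + 1 : ℕ) : ℝ) + 1) * x) = sin (2 * ((n : ℝ) + 1) * x + x) := by
      push_cast; ring_nf
    have h2 : sin ((2 * (n : ℝ) + 1) * x) = sin (2 * ((n : ℝ) + 1) * x - x) := by ring_nf
    rw [e, h1, h2, sin_add, sin_sub]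
    push_cast
    ring

lemma sum_sub_abs_mul_cos_mul_sin_sq (n : ℕ) (x : ℝ) :
    (∑ k ∈ Finset.Icc (-(n : ℤ)) n, ((n : ℝ) + 1 - |(k : ℝ)|) * cos (2 * k * x)) * sin x ^ 2 =
      sin ((n + 1) * x) ^ 2 := by
  induction n with
  | zero => simp
  | succ n ih =>
    have hsum : ∑ k ∈ Finset.Icc (-((n + 1 : ℕ) : ℤ)) ((n + 1 : ℕ) : ℤ),
        (((n + 1 : ℕ) : ℝ) + 1 - |(k : ℝ)|) * cos (2 * k * x) =
        ∑ k ∈ Finset.Icc (-((n + 1 : ℕ) : ℤ)) ((n + 1 : ℕ) : ℤ), cos (2 * k * x) +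
        ∑ k ∈ Finset.Icc (-(n : ℤ)) n, ((n : ℝ) + 1 - |(k : ℝ)|) * cos (2 * k * x) := by
      have hn : |(n : ℝ) + 1| = n + 1 := abs_of_nonneg (by positivity)
      have hn' : |-1 + -(n : ℝ)| = n + 1 := by rw [← abs_neg]; convert hn using 2; ring
      have h0 : ∑ k ∈ Finset.Icc (-(n : ℤ)) n, ((n : ℝ) + 1 - |(k : ℝ)|) * cos (2 * k * x) =
          ∑ k ∈ Finset.Icc (-((n + 1 : ℕ) : ℤ)) ((n + 1 : ℕ) : ℤ),
            ((n : ℝ) + 1 - |(k : ℝ)|) * cos (2 * k * x) := by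
        rw [sum_Icc_neg_succ (fun k => ((n : ℝ) + 1 - |(k : ℝ)|) * cos (2 * k * x))]
        simp [hn, hn']
      rw [h0, ← Finset.sum_add_distrib]
      refine Finset.sum_congr rfl fun k _ => ?_
      push_cast
      ring
    have hD := sum_cos_mul_sin (n + 1) x
    rw [hsum, add_mul, ih, sq (sin x), ← mul_assoc, hD]
    have h1 : sin ((2 * ((n + 1 : ℕ) : ℝ) + 1) * x) =
        sin (((n + 1 : ℕ) + 1) * x + ((n : ℝ) + 1) * x) := by
      push_cast; ring_nf
    have h2 : sin x = sin (((n + 1 : ℕ) + 1) * x - ((n : ℝ) + 1) * x) := by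
      push_cast; ring_nf
    rw [h1, h2, sin_add, sin_sub]
    have e₁ := sin_sq_add_cos_sq ((((n + 1 : ℕ) : ℝ) + 1) * x)
    have e₂ := sin_sq_add_cos_sq (((n : ℝ) + 1) * x)
    rw [← sub_eq_zero] at e₁ e₂ ⊢
    linear_combination sin ((((n + 1 : ℕ) : ℝ) + 1) * x) ^ 2 * e₂ -
      sin (((n : ℝ) + 1) * x) ^ 2 * e₁

lemma fejer_mul_sin_sq (n : ℕ) (t : ℝ) :
    fejer n t * sin (π * t) ^ 2 = sin (((n : ℝ) + 1) * (π * t)) ^ 2 / ((n : ℝ) + 1) ^ 2 := by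
  have hM : (n : ℝ) + 1 ≠ 0 := by positivity
  rw [← sum_sub_abs_mul_cos_mul_sin_sq, fejer, mul_right_comm, mul_right_comm, mul_div_right_comm]
  congr 1
  rw [Finset.mul_sum, Finset.sum_div]
  refine Finset.sum_congr rfl fun k _ => ?_
  rw [show 2 * π * (k : ℝ) * t = 2 * k * (π * t) by ring]
  field_simp

/-- The first derivative of the Fejér kernel. -/
noncomputable def fejerDeriv (n : ℕ) (t : ℝ) : ℝ :=
  (1 / (n + 1)) * ∑ k ∈ Finset.Icc (-(n : ℤ)) n,
    (1 - |(k : ℝ)| / (n + 1)) * (-(2 * π * k) * sin (2 * π * k * t))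

/-- The second derivative of the Fejér kernel. -/
noncomputable def fejerDerivTwo (n : ℕ) (t : ℝ) : ℝ :=
  (1 / (n + 1)) * ∑ k ∈ Finset.Icc (-(n : ℤ)) n,
    (1 - |(k : ℝ)| / (n + 1)) * (-(2 * π * k) ^ 2 * cos (2 * π * k * t))

lemma hasDerivAt_fejer (n : ℕ) (t : ℝ) : HasDerivAt (fejer n) (fejerDeriv n t) t := by
  refine HasDerivAt.const_mul _ (HasDerivAt.fun_sum fun k _ => HasDerivAt.const_mul _ ?_)
  have h := ((hasDerivAt_id' t).const_mul (2 * π * (k : ℝ))).cos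
  rwa [mul_one, neg_mul, mul_comm (sin _), ← neg_mul] at h

lemma hasDerivAt_fejerDeriv (n : ℕ) (t : ℝ) :
    HasDerivAt (fejerDeriv n) (fejerDerivTwo n t) t := by
  refine HasDerivAt.const_mul _ (HasDerivAt.fun_sum fun k _ => HasDerivAt.const_mul _ ?_)
  convert (((hasDerivAt_id' t).const_mul (2 * π * (k : ℝ))).sin).const_mul (-(2 * π * (k : ℝ)))
    using 1
  ring

lemma iteratedDeriv_two_fejer (n : ℕ) : iteratedDeriv 2 (fejer n) = fejerDerivTwo n := by
  have h1 : deriv (fejer n) = fejerDeriv n := funext fun t => (hasDerivAt_fejer n t).deriv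
  rw [iteratedDeriv_succ, iteratedDeriv_one, h1]
  exact funext fun t => (hasDerivAt_fejerDeriv n t).deriv

lemma abs_fejerDerivTwo_le (n : ℕ) (t : ℝ) :
    |fejerDerivTwo n t| ≤ 8 * π ^ 2 * ((n : ℝ) + 1) ^ 2 := by
  have hM : 0 < (n : ℝ) + 1 := by positivity
  have hterm : ∀ k ∈ Finset.Icc (-(n : ℤ)) n,
      |(1 - |(k : ℝ)| / (n + 1)) * (-(2 * π * k) ^ 2 * cos (2 * π * k * t))| ≤
        4 * π ^ 2 * ((n : ℝ) + 1) ^ 2 := by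
    intro k hk
    rw [Finset.mem_Icc] at hk
    have hk' : |(k : ℝ)| ≤ (n : ℝ) + 1 := by
      rw [← Int.cast_abs]
      have : |k| ≤ (n : ℤ) := abs_le.2 hk
      have : ((|k| : ℤ) : ℝ) ≤ ((n : ℤ) : ℝ) := by exact_mod_cast this
      push_cast at this ⊢
      linarith
    have h1 : |1 - |(k : ℝ)| / (n + 1)| ≤ 1 := by
      have h2 : |(k : ℝ)| / (n + 1) ≤ 1 := (div_le_one hM).2 hk'
      have h3 : 0 ≤ |(k : ℝ)| / (n + 1) := by positivity
      rw [abs_le]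
      constructor <;> linarith
    have h4 : |-(2 * π * (k : ℝ)) ^ 2 * cos (2 * π * k * t)| ≤ 4 * π ^ 2 * ((n : ℝ) + 1) ^ 2 := by
      rw [abs_mul, abs_neg, abs_of_nonneg (sq_nonneg (2 * π * (k : ℝ)))]
      calc (2 * π * (k : ℝ)) ^ 2 * |cos (2 * π * k * t)| ≤ (2 * π * (k : ℝ)) ^ 2 * 1 := by
            gcongr; exact abs_cos_le_one _
        _ = 4 * π ^ 2 * |(k : ℝ)| ^ 2 := by rw [sq_abs]; ring
        _ ≤ _ := by gcongr
    rw [abs_mul]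
    calc _ ≤ 1 * (4 * π ^ 2 * ((n : ℝ) + 1) ^ 2) := by gcongr
      _ = _ := one_mul _
  have hs := (Finset.abs_sum_le_sum_abs _ _).trans (Finset.sum_le_sum hterm)
  rw [Finset.sum_const, Int.card_Icc, nsmul_eq_mul] at hs
  have hcard : ((((n : ℤ) + 1 - -(n : ℤ)).toNat : ℕ) : ℝ) = 2 * n + 1 := by
    rw [show ((n : ℤ) + 1 - -(n : ℤ)).toNat = 2 * n + 1 by omega]; push_cast; ring
  rw [hcard] at hs
  rw [fejerDerivTwo, abs_mul, abs_of_pos (by positivity : 0 < 1 / ((n : ℝ) + 1)),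
    one_div_mul_eq_div, div_le_iff₀ hM]
  refine hs.trans ?_
  have : 0 ≤ π ^ 2 * ((n : ℝ) + 1) ^ 2 := by positivity
  nlinarith

/-- The second derivative of the closed form of the Fejér kernel, with denominators cleared. -/
lemma fejerDerivTwo_mul_sin_pow_four (n : ℕ) (t : ℝ) (ht : sin (π * t) ≠ 0) :
    fejerDerivTwo n t * ((n : ℝ) + 1) ^ 2 * sin (π * t) ^ 4 = π ^ 2 *
      (2 * ((n + 1) * sin (π * t)) ^ 2 *
          (cos ((n + 1) * (π * t)) ^ 2 - sin ((n + 1) * (π * t)) ^ 2) -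
        8 * ((n + 1) * sin (π * t)) * cos (π * t) * sin ((n + 1) * (π * t)) *
          cos ((n + 1) * (π * t)) +
        sin ((n + 1) * (π * t)) ^ 2 * (6 * cos (π * t) ^ 2 + 2 * sin (π * t) ^ 2)) := by
  set M : ℝ := (n : ℝ) + 1
  have hM : M ≠ 0 := by positivity
  have hs : ∀ t, HasDerivAt (fun t => sin (π * t)) (π * cos (π * t)) t := fun t => by
    convert ((hasDerivAt_id' t).const_mul π).sin using 1
    ring
  have hc : ∀ t, HasDerivAt (fun t => cos (π * t)) (-(π * sin (π * t))) t := fun t => by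
    convert ((hasDerivAt_id' t).const_mul π).cos using 1
    ring
  have hS : ∀ t, HasDerivAt (fun t => sin (M * (π * t))) (M * π * cos (M * (π * t))) t :=
    fun t => by
      convert (((hasDerivAt_id' t).const_mul π).const_mul M).sin using 1
      ring
  have hC : ∀ t, HasDerivAt (fun t => cos (M * (π * t))) (-(M * π * sin (M * (π * t)))) t :=
    fun t => by
      convert (((hasDerivAt_id' t).const_mul π).const_mul M).cos using 1
      ring
  have e0 : (fun t => fejer n t * sin (π * t) ^ 2) = fun t => sin (M * (π * t)) ^ 2 / M ^ 2 :=
    funext fun t => fejer_mul_sin_sq n t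
  have e1 : (fun t => fejerDeriv n t * sin (π * t) ^ 2 +
        fejer n t * (2 * sin (π * t) * (π * cos (π * t)))) =
      fun t => 2 * sin (M * (π * t)) * (M * π * cos (M * (π * t))) / M ^ 2 := by
    funext t
    have h1 := (hasDerivAt_fejer n t).fun_mul ((hs t).fun_pow 2)
    have h2 := ((hS t).fun_pow 2).div_const (M ^ 2)
    rw [e0] at h1
    simpa using h1.unique h2
  have e2 := by
    have h1 := ((hasDerivAt_fejerDeriv n t).fun_mul ((hs t).fun_pow 2)).fun_add
      ((hasDerivAt_fejer n t).fun_mul (((hs t).const_mul 2).fun_mul ((hc t).const_mul π)))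
    have h2 := ((((hS t).const_mul 2).fun_mul ((hC t).const_mul (M * π))).div_const (M ^ 2))
    rw [e1] at h1
    exact h1.unique h2
  have e0t := congrFun e0 t
  have e1t := congrFun e1 t
  generalize fejerDerivTwo n t = F2 at *
  generalize fejerDeriv n t = F1 at *
  generalize fejer n t = F0 at *
  generalize sin (π * t) = s at *
  generalize cos (π * t) = c at *
  generalize sin (M * (π * t)) = S at *
  generalize cos (M * (π * t)) = C at *
  have hF0 : F0 = S ^ 2 / M ^ 2 / s ^ 2 := by field_simp at e0t ⊢; linarith
  have hF1 : F1 = (2 * S * (M * π * C) / M ^ 2 - F0 * (2 * s * (π * c))) / s ^ 2 := by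
    rw [eq_div_iff (by positivity)]; linarith
  have hF2 : F2 = ((2 * (M * π * C) * (M * π * C) + 2 * S * (M * π * -(M * π * S))) / M ^ 2 -
      F1 * (2 * s * (π * c)) * 2 - F0 * (2 * (π * c) * (π * c) + 2 * s * (π * -(π * s)))) / s ^ 2 := by
    rw [eq_div_iff (by positivity)]; linarith
  rw [hF2, hF1, hF0]
  field_simp
  ring

lemma abs_fejer_numerator_le {a k s S C : ℝ} (hsk : s ^ 2 ≤ a ^ 2) (hka : k ^ 2 ≤ a ^ 2)
    (hSC : S ^ 2 + C ^ 2 = 1) :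
    |2 * a ^ 2 * (C ^ 2 - S ^ 2) - 8 * a * k * S * C + S ^ 2 * (6 * k ^ 2 + 2 * s ^ 2)| ≤
      2 * a ^ 2 + 4 * (|a| * |k|) + 4 * k ^ 2 := by
  have hC : C ^ 2 = 1 - S ^ 2 := by linarith
  have h1 : |a * k * (2 * (S * C))| ≤ |a| * |k| := by
    rw [abs_mul, abs_mul a k]
    refine mul_le_of_le_one_right (by positivity) (abs_le.2 ⟨?_, ?_⟩)
    · nlinarith [sq_nonneg (S + C)]
    · nlinarith [sq_nonneg (S - C)]
  obtain ⟨h2, h3⟩ := abs_le.1 h1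
  have hS0 := sq_nonneg S
  have hS1 : S ^ 2 ≤ 1 := by nlinarith [sq_nonneg C]
  rw [hC, abs_le]
  constructor
  · nlinarith [mul_nonneg hS0 (sq_nonneg k), mul_nonneg hS0 (sq_nonneg s),
      mul_nonneg (sub_nonneg.2 hS1) (sq_nonneg a), sq_nonneg k]
  · nlinarith [mul_nonneg hS0 (sub_nonneg.2 hsk), mul_nonneg hS0 (sub_nonneg.2 hka),
      mul_nonneg (sub_nonneg.2 hS1) (sq_nonneg k)]

lemma abs_fejerDerivTwo_le_of_sin_ne_zero (n : ℕ) (t : ℝ) (ht : sin (π * t) ≠ 0) :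
    |fejerDerivTwo n t| ≤ 2 * π ^ 2 * (1 / sin (π * t) ^ 2) + ((n : ℝ) + 1) ^ 2 *
      (4 / π / (((n : ℝ) + 1) * |t + (-round t : ℤ)|) ^ 3 +
        4 / π ^ 2 / (((n : ℝ) + 1) * |t + (-round t : ℤ)|) ^ 4) := by
  have hnum := fejerDerivTwo_mul_sin_pow_four n t ht
  have htriv := abs_fejerDerivTwo_le n t
  have hs1 := abs_sin_pi_mul_add_int t (-round t)
  have hc1 := abs_cos_pi_mul_add_int t (-round t)
  have hr : |t + (-round t : ℤ)| ≤ 1 / 2 := by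
    simpa [sub_eq_add_neg] using abs_sub_round t
  have hM1 : 1 ≤ (n : ℝ) + 1 := by linarith [n.cast_nonneg (α := ℝ)]
  have hx : |π * (t + (-round t : ℤ))| ≤ π / 2 := by
    rw [abs_mul, abs_of_pos pi_pos]; nlinarith [pi_pos]
  have h1 := sq_mul_cos_sq_le_sin_sq hx
  have h3 := abs_cos_mul_cube_le hx
  have h4 := cos_sq_mul_pow_four_le hx
  rw [← sq_abs (cos _), ← sq_abs (sin _), hs1, hc1, ← sq_abs (π * _)] at h1
  rw [← sq_abs (cos _), hs1, hc1] at h4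
  rw [hs1, hc1] at h3
  rw [abs_mul π, abs_of_pos pi_pos] at h1 h3 h4
  have hy : 0 < |t + (-round t : ℤ)| := by
    rw [abs_pos]
    intro h
    rw [h, mul_zero, sin_zero, abs_zero] at hs1
    exact ht (abs_eq_zero.1 hs1.symm)
  have hSC := sin_sq_add_cos_sq (((n : ℝ) + 1) * (π * t))
  generalize |t + (-round t : ℤ)| = y at *
  generalize fejerDerivTwo n t = F at *
  generalize (n : ℝ) + 1 = M at *
  generalize sin (π * t) = s at *
  generalize cos (π * t) = c at *
  generalize sin (M * (π * t)) = S at *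
  generalize cos (M * (π * t)) = C at *
  have hs : 0 < |s| := abs_pos.2 ht
  have hM : 0 < M := by linarith
  have hπ := pi_pos
  rcases le_or_gt (c ^ 2) ((M * s) ^ 2) with hcs | hcs
  · have hsM : s ^ 2 ≤ (M * s) ^ 2 := by
      rw [mul_pow]
      exact le_mul_of_one_le_left (sq_nonneg s) (one_le_pow₀ hM1)
    have hb := abs_fejer_numerator_le hsM hcs hSC
    have hF : |F| * (M ^ 2 * |s| ^ 4) ≤
        π ^ 2 * (2 * (M * |s|) ^ 2 + 4 * (M * |s| * |c|) + 4 * |c| ^ 2) := by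
      have e : |F| * (M ^ 2 * |s| ^ 4) = |F * M ^ 2 * s ^ 4| := by
        rw [abs_mul, abs_mul, abs_pow, abs_pow, abs_of_pos hM]; ring
      rw [e, hnum, abs_mul, abs_of_nonneg (sq_nonneg π)]
      refine mul_le_mul_of_nonneg_left (hb.trans_eq ?_) (sq_nonneg π)
      rw [abs_mul, abs_of_pos hM, ← sq_abs (M * s), abs_mul, abs_of_pos hM, sq_abs c]
    have hF' : |F| ≤ 2 * π ^ 2 * (1 / |s| ^ 2) + 4 * π ^ 2 / M * (|c| / |s| ^ 3) +
        4 * π ^ 2 / M ^ 2 * (|c| ^ 2 / |s| ^ 4) := by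
      rw [← le_div_iff₀ (by positivity)] at hF
      refine hF.trans_eq ?_
      field_simp
    have h3' : |c| / |s| ^ 3 ≤ 1 / (π * y) ^ 3 := by
      rw [div_le_div_iff₀ (by positivity) (by positivity)]; linarith
    have h4' : |c| ^ 2 / |s| ^ 4 ≤ 1 / (π * y) ^ 4 := by
      rw [div_le_div_iff₀ (by positivity) (by positivity)]; linarith
    rw [← sq_abs s]
    calc |F| ≤ _ := hF'
      _ ≤ 2 * π ^ 2 * (1 / |s| ^ 2) + 4 * π ^ 2 / M * (1 / (π * y) ^ 3) +
        4 * π ^ 2 / M ^ 2 * (1 / (π * y) ^ 4) := by gcongr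
      _ = _ := by field_simp; ring
  · have hMy : π * (M * y) ≤ 1 := by
      have hc0 : 0 < c ^ 2 := (sq_nonneg _).trans_lt hcs
      rw [sq_abs, sq_abs] at h1
      have : (π * (M * y)) ^ 2 * c ^ 2 ≤ 1 * c ^ 2 := by
        have := mul_le_mul_of_nonneg_left h1 (sq_nonneg M)
        nlinarith
      exact (sq_le_one_iff₀ (by positivity)).1 (le_of_mul_le_mul_right this hc0)
    have hMy' : M * y ≤ 1 / π := by rw [le_div_iff₀ hπ]; linarith
    calc |F| ≤ 8 * π ^ 2 * M ^ 2 := htriv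
      _ = 0 + M ^ 2 * (4 / π / (1 / π) ^ 3 + 4 / π ^ 2 / (1 / π) ^ 4) := by field_simp; ring
      _ ≤ _ := by gcongr; positivity

/-! ### Midpoint comparisons for inverse powers -/

lemma inv_sq_le_midpoint {δ y : ℝ} (hδ : 0 < δ) (hy : δ / 2 < y) :
    δ * (2 / y ^ 2) ≤ 2 / (y - δ / 2) - 2 / (y + δ / 2) := by
  have h1 : 0 < y - δ / 2 := by linarith
  have h2 : 0 < y + δ / 2 := by linarith
  have h3 : 0 < (y - δ / 2) * (y + δ / 2) := mul_pos h1 h2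
  calc δ * (2 / y ^ 2) = 2 * δ / y ^ 2 := by ring
    _ ≤ 2 * δ / ((y - δ / 2) * (y + δ / 2)) := by gcongr; nlinarith
    _ = _ := by
      have hδ' : δ = (y + δ / 2) - (y - δ / 2) := by ring
      generalize y + δ / 2 = q at *
      generalize y - δ / 2 = p at *
      subst hδ'
      field_simp

lemma inv_cube_le_midpoint {δ y : ℝ} (hδ : 0 < δ) (hy : δ / 2 < y) :
    δ * (2 / y ^ 3) ≤ 1 / (y - δ / 2) ^ 2 - 1 / (y + δ / 2) ^ 2 := by
  have h1 : 0 < y - δ / 2 := by linarith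
  have h2 : 0 < y + δ / 2 := by linarith
  have h0 : 0 < y := by linarith
  have h3 : 0 < (y - δ / 2) * (y + δ / 2) := mul_pos h1 h2
  calc δ * (2 / y ^ 3) = 2 * δ * y / (y ^ 2) ^ 2 := by field_simp
    _ ≤ 2 * δ * y / ((y - δ / 2) * (y + δ / 2)) ^ 2 := by gcongr; nlinarith
    _ = _ := by
      have hδ' : δ = (y + δ / 2) - (y - δ / 2) := by ring
      have hy' : y = ((y + δ / 2) + (y - δ / 2)) / 2 := by ring
      generalize y + δ / 2 = q at *
      generalize y - δ / 2 = p at *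
      subst hδ' hy'
      field_simp
      ring

lemma inv_pow_four_le_midpoint {δ y : ℝ} (hδ : 0 < δ) (hy : δ / 2 < y) :
    δ * (3 / y ^ 4) ≤ 1 / (y - δ / 2) ^ 3 - 1 / (y + δ / 2) ^ 3 := by
  have h1 : 0 < y - δ / 2 := by linarith
  have h2 : 0 < y + δ / 2 := by linarith
  have h0 : 0 < y := by linarith
  have h3 : 0 < (y - δ / 2) * (y + δ / 2) := mul_pos h1 h2
  calc δ * (3 / y ^ 4) = 3 * δ * y ^ 2 / (y ^ 2) ^ 3 := by field_simp
    _ ≤ (3 * δ * y ^ 2 + δ ^ 3 / 4) / ((y - δ / 2) * (y + δ / 2)) ^ 3 := by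
      gcongr
      · linarith [pow_pos hδ 3]
      · nlinarith
    _ = _ := by
      have hδ' : δ = (y + δ / 2) - (y - δ / 2) := by ring
      have hy' : y = ((y + δ / 2) + (y - δ / 2)) / 2 := by ring
      generalize y + δ / 2 = q at *
      generalize y - δ / 2 = p at *
      subst hδ' hy'
      field_simp
      ring

lemma sep_le_one {r : ℕ} (τ : Fin r → ℝ) {i j : Fin r} (hij : i ≠ j) : sep τ ≤ 1 := by
  refine (sep_le τ hij (-round (τ i - τ j))).trans ?_
  have := abs_sub_round (τ i - τ j)
  push_cast
  rw [← sub_eq_add_neg]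
  linarith

lemma sep_le_abs_sub {r : ℕ} (τ : Fin r → ℝ) {i j j' : Fin r} (hj : j ≠ i) (k k' : ℤ)
    (h : j ≠ j' ∨ k ≠ k') : sep τ ≤ |(τ j - τ i + k) - (τ j' - τ i + k')| := by
  rcases eq_or_ne j j' with rfl | hjj
  · have hk : k - k' ≠ 0 := sub_ne_zero.2 (h.resolve_left (by simp))
    have h1 : (1 : ℝ) ≤ |((k - k' : ℤ) : ℝ)| := by
      rw [← Int.cast_abs]; exact_mod_cast Int.one_le_abs hk
    refine (sep_le_one τ hj).trans (h1.trans_eq ?_)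
    push_cast; congr 1; ring
  · refine (sep_le τ hjj (k - k')).trans_eq ?_
    push_cast; congr 1; ring

lemma div_pow_sub_le {α β δ : ℝ} (hβ0 : 0 ≤ β) (hβ : β < α / 2) (hδ : α ≤ δ) {p : ℕ}
    (hp : p ≠ 0) : δ * ((δ - 2 * β)⁻¹) ^ p ≤ α * ((α - 2 * β)⁻¹) ^ p := by
  obtain ⟨q, rfl⟩ := Nat.exists_eq_succ_of_ne_zero hp
  have h1 : 0 < α - 2 * β := by linarith
  have h2 : 0 < δ - 2 * β := by linarith
  have h3 : δ * (δ - 2 * β)⁻¹ ≤ α * (α - 2 * β)⁻¹ := by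
    rw [← div_eq_mul_inv, ← div_eq_mul_inv, div_le_div_iff₀ h2 h1]
    nlinarith
  have h4 : (δ - 2 * β)⁻¹ ≤ (α - 2 * β)⁻¹ := by gcongr
  have h5 : 0 ≤ α * (α - 2 * β)⁻¹ := mul_nonneg (by linarith) (by positivity)
  rw [pow_succ', pow_succ', ← mul_assoc, ← mul_assoc]
  gcongr

theorem sum_abs_second_deriv_fejer_le (n r : ℕ) (hn : 2 ≤ n) (τ : Fin r → ℝ) (α β : ℝ)
    (hα : 0 < α) (hsep : α ≤ ((n : ℝ) + 1) * sep τ)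
    (u : Fin r → Fin r → ℝ) (hu : ∀ i j, i ≠ j → ((n : ℝ) + 1) * |u i j| ≤ β)
    (hβ : β < α / 2) (i : Fin r) :
    ∑ j ∈ Finset.univ.erase i, |iteratedDeriv 2 (fejer n) (τ j - τ i + u i j)| ≤
      (((80 / 9) * (α - 2 * β)⁻¹ + (16 / π) * ((α - 2 * β)⁻¹) ^ 2 +
          (64 / (3 * π ^ 2)) * ((α - 2 * β)⁻¹) ^ 3) * α) * ((n : ℝ) + 1) ^ 2 *
        (((n : ℝ) + 1) * sep τ)⁻¹ ^ 2 := by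
  have hγ : 0 < α - 2 * β := by linarith
  rcases (Finset.univ.erase i).eq_empty_or_nonempty with hE | ⟨j₀, hj₀⟩
  · rw [hE, Finset.sum_empty]
    positivity
  have hM : 0 < (n : ℝ) + 1 := by positivity
  have hβ0 : 0 ≤ β :=
    (by positivity : 0 ≤ ((n : ℝ) + 1) * |u i j₀|).trans (hu i j₀ (Finset.ne_of_mem_erase hj₀).symm)
  have hδ : 0 < ((n : ℝ) + 1) * sep τ := hα.trans_le hsep
  have hβδ : 2 * β < ((n : ℝ) + 1) * sep τ := by linarith
  have hπ := pi_pos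
  rw [iteratedDeriv_two_fejer]
  set M : ℝ := (n : ℝ) + 1
  set δ := M * sep τ
  set E := Finset.univ.erase i
  have hvδ : ∀ j ∈ E, ∀ k : ℤ, δ ≤ |M * (τ j - τ i + k)| := by
    intro j hj k
    rw [abs_mul, abs_of_pos hM]
    refine mul_le_mul_of_nonneg_left ?_ hM.le
    exact sep_le τ (Finset.ne_of_mem_erase hj) k
  have hvw : ∀ j ∈ E, ∀ k : ℤ,
      |M * (τ j - τ i + k)| - β ≤ M * |τ j - τ i + u i j + k| := by
    intro j hj k
    have h1 := hu i j (Finset.ne_of_mem_erase hj).symm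
    have h2 : |τ j - τ i + k| ≤ |τ j - τ i + u i j + k| + |u i j| := by
      have := abs_sub (τ j - τ i + u i j + k) (u i j)
      rwa [show τ j - τ i + u i j + k - u i j = τ j - τ i + k by ring] at this
    have h3 := mul_le_mul_of_nonneg_left h2 hM.le
    rw [abs_mul, abs_of_pos hM]
    linarith
  have hvsep : ∀ j ∈ E, ∀ j' : Fin r, ∀ k k' : ℤ, (j ≠ j' ∨ k ≠ k') →
      δ ≤ |M * (τ j - τ i + k) - M * (τ j' - τ i + k')| := by
    intro j hj j' k k' h
    rw [← mul_sub, abs_mul, abs_of_pos hM]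
    refine mul_le_mul_of_nonneg_left ?_ hM.le
    exact sep_le_abs_sub τ (Finset.ne_of_mem_erase hj) k k' h
  have hsin : ∀ j ∈ E, sin (π * (τ j - τ i + u i j)) ≠ 0 := by
    intro j hj h
    obtain ⟨k, hk⟩ := sin_eq_zero_iff.1 h
    have hk' : τ j - τ i + u i j + (-k : ℤ) = 0 := by
      rw [mul_comm] at hk
      have := mul_left_cancel₀ hπ.ne' hk
      push_cast; linarith
    have h1 := hvw j hj (-k)
    rw [hk', abs_zero, mul_zero] at h1
    linarith [hvδ j hj (-k)]
  have hfar : δ * ∑ j ∈ E, (4 / π / (M * |τ j - τ i + u i j +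
        (-round (τ j - τ i + u i j) : ℤ)|) ^ 3 +
      4 / π ^ 2 / (M * |τ j - τ i + u i j + (-round (τ j - τ i + u i j) : ℤ)|) ^ 4) ≤
      2 * (2 / π * (1 / (δ / 2 - β) ^ 2) + 4 / (3 * π ^ 2) * (1 / (δ / 2 - β) ^ 3)) := by
    refine sum_le_of_separated (g := fun y => 4 / π / y ^ 3 + 4 / π ^ 2 / y ^ 4)
      (G := fun y => 2 / π * (1 / y ^ 2) + 4 / (3 * π ^ 2) * (1 / y ^ 3)) hδ hβδ
      (fun y hy => by positivity) (fun y z hy hyz => by gcongr)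
      (fun y hy => by positivity) ?_ E
      (fun j => M * (τ j - τ i + (-round (τ j - τ i + u i j) : ℤ))) _
      (fun j hj => hvδ j hj _) (fun j hj => hvw j hj _)
      (fun j hj j' _ hne => hvsep j hj j' _ _ (.inl hne))
    intro y hy
    have h3 := mul_le_mul_of_nonneg_left (inv_cube_le_midpoint hδ hy)
      (by positivity : 0 ≤ 2 / π)
    have h4 := mul_le_mul_of_nonneg_left (inv_pow_four_le_midpoint hδ hy)
      (by positivity : 0 ≤ 4 / (3 * π ^ 2))
    have hy0 : 0 < y := by linarith
    have e : δ * (4 / π / y ^ 3 + 4 / π ^ 2 / y ^ 4) =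
        2 / π * (δ * (2 / y ^ 3)) + 4 / (3 * π ^ 2) * (δ * (3 / y ^ 4)) := by
      field_simp
      ring
    rw [e]
    linarith
  have hnear : ∀ K : Fin r → Finset ℤ,
      δ * ∑ j ∈ E, ∑ k ∈ K j, 2 / (M * |τ j - τ i + u i j + k|) ^ 2 ≤
        2 * (2 / (δ / 2 - β)) := by
    intro K
    have := sum_le_of_separated (g := fun y => 2 / y ^ 2) (G := fun y => 2 / y) hδ hβδ
      (fun y hy => by positivity) (fun y z hy hyz => by gcongr)
      (fun y hy => by positivity) (fun y hy => inv_sq_le_midpoint hδ hy) (E.sigma K)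
      (fun a => M * (τ a.1 - τ i + a.2)) (fun a => M * |τ a.1 - τ i + u i a.1 + a.2|)
      (fun a ha => hvδ a.1 (Finset.mem_sigma.1 ha).1 a.2)
      (fun a ha => hvw a.1 (Finset.mem_sigma.1 ha).1 a.2)
      (fun a ha b _ hne => hvsep a.1 (Finset.mem_sigma.1 ha).1 b.1 a.2 b.2 ?_)
    · rwa [Finset.sum_sigma] at this
    · by_contra! h
      exact hne (Sigma.ext h.1 (heq_of_eq h.2))
  have hη : 0 < δ - 2 * β := by linarith
  have hlim : ∀ p : ℕ, ∑ j ∈ E, |fejerDerivTwo n (τ j - τ i + u i j)| ≤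
      M ^ 2 * δ⁻¹ * (8 * (δ - 2 * β)⁻¹ + 16 / π * ((δ - 2 * β)⁻¹) ^ 2 +
        64 / (3 * π ^ 2) * ((δ - 2 * β)⁻¹) ^ 3) + E.card * (2 * π ^ 2) * (1 / 2) ^ p := by
    intro p
    have hex : ∀ j, ∃ K : Finset ℤ, j ∈ E → 1 / sin (π * (τ j - τ i + u i j)) ^ 2 ≤
        ∑ k ∈ K, 1 / (π * (τ j - τ i + u i j + k)) ^ 2 + (1 / 2) ^ p := by
      intro j
      by_cases hj : j ∈ E
      · obtain ⟨K, hK⟩ := exists_one_div_sin_sq_le p _ (hsin j hj)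
        exact ⟨K, fun _ => hK⟩
      · exact ⟨∅, fun h => absurd h hj⟩
    choose K hK using hex
    have hpt : ∀ j ∈ E, |fejerDerivTwo n (τ j - τ i + u i j)| ≤
        M ^ 2 * (∑ k ∈ K j, 2 / (M * |τ j - τ i + u i j + k|) ^ 2) + M ^ 2 *
          (4 / π / (M * |τ j - τ i + u i j + (-round (τ j - τ i + u i j) : ℤ)|) ^ 3 +
            4 / π ^ 2 / (M * |τ j - τ i + u i j + (-round (τ j - τ i + u i j) : ℤ)|) ^ 4) +
        2 * π ^ 2 * (1 / 2) ^ p := by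
      intro j hj
      have h1 := abs_fejerDerivTwo_le_of_sin_ne_zero n _ (hsin j hj)
      have h2 := mul_le_mul_of_nonneg_left (hK j hj) (by positivity : 0 ≤ 2 * π ^ 2)
      have e : 2 * π ^ 2 * ∑ k ∈ K j, 1 / (π * (τ j - τ i + u i j + k)) ^ 2 =
          M ^ 2 * ∑ k ∈ K j, 2 / (M * |τ j - τ i + u i j + k|) ^ 2 := by
        rw [Finset.mul_sum, Finset.mul_sum]
        refine Finset.sum_congr rfl fun k _ => ?_
        have h0 : M ^ 2 * (2 / M ^ 2) = 2 * π ^ 2 * (1 / π ^ 2) := by field_simp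
        rw [mul_pow, mul_pow, sq_abs, ← div_div, ← div_div, div_eq_mul_inv (1 / π ^ 2),
          div_eq_mul_inv (2 / M ^ 2), ← mul_assoc, ← mul_assoc (M ^ 2), h0]
      rw [mul_add (2 * π ^ 2), e] at h2
      linarith
    refine (Finset.sum_le_sum hpt).trans ?_
    rw [Finset.sum_add_distrib, Finset.sum_add_distrib, ← Finset.mul_sum, ← Finset.mul_sum,
      Finset.sum_const, nsmul_eq_mul, ← mul_assoc]
    refine add_le_add ?_ le_rfl
    rw [← mul_add, mul_assoc]
    refine mul_le_mul_of_nonneg_left ?_ (by positivity)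
    rw [inv_mul_eq_div, le_div_iff₀ hδ, mul_comm, mul_add]
    refine (add_le_add (hnear K) hfar).trans_eq ?_
    rw [show δ / 2 - β = (δ - 2 * β) / 2 by ring]
    field_simp
    ring
  have hmain : ∑ j ∈ E, |fejerDerivTwo n (τ j - τ i + u i j)| ≤
      M ^ 2 * δ⁻¹ * (8 * (δ - 2 * β)⁻¹ + 16 / π * ((δ - 2 * β)⁻¹) ^ 2 +
        64 / (3 * π ^ 2) * ((δ - 2 * β)⁻¹) ^ 3) := by
    have ht := (tendsto_pow_atTop_nhds_zero_of_lt_one (r := (1 / 2 : ℝ)) (by norm_num)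
      (by norm_num)).const_mul (E.card * (2 * π ^ 2))
    have ht' := ht.const_add (M ^ 2 * δ⁻¹ * (8 * (δ - 2 * β)⁻¹ +
      16 / π * ((δ - 2 * β)⁻¹) ^ 2 + 64 / (3 * π ^ 2) * ((δ - 2 * β)⁻¹) ^ 3))
    rw [mul_zero, add_zero] at ht'
    exact ge_of_tendsto' ht' hlim
  have q1 := div_pow_sub_le hβ0 hβ hsep one_ne_zero
  have q2 := div_pow_sub_le hβ0 hβ hsep two_ne_zero
  have q3 := div_pow_sub_le hβ0 hβ hsep three_ne_zero
  rw [pow_one, pow_one] at q1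
  calc _ ≤ _ := hmain
    _ = M ^ 2 * δ⁻¹ ^ 2 * (8 * (δ * (δ - 2 * β)⁻¹) + 16 / π * (δ * ((δ - 2 * β)⁻¹) ^ 2) +
        64 / (3 * π ^ 2) * (δ * ((δ - 2 * β)⁻¹) ^ 3)) := by
      field_simp
    _ ≤ M ^ 2 * δ⁻¹ ^ 2 * (80 / 9 * (α * (α - 2 * β)⁻¹) + 16 / π * (α * ((α - 2 * β)⁻¹) ^ 2) +
        64 / (3 * π ^ 2) * (α * ((α - 2 * β)⁻¹) ^ 3)) := by
      gcongr
      norm_num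
    _ = _ := by ring
end
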